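/- arXiv:2002.05094 — 2 statements merged into one kernel-verified Lean document; each statement's English description precedes it below -/
import Mathlib

section
/- Let (a_k)_{k∈ℤ} be positive reals with Σ_{k∈ℤ} |a_{k-1} − a_k| < ∞ and lim_{k→+∞} a_k = lim_{k→-∞} a_k. Suppose that for every n ≥ 1 the series I_n := Σ_{k∈ℤ} ( (a_k/a_{k-n})² − 1 ) a_k converges absolutely, and that there exists a sequence (b_n)_{n≥1} of positive reals with Σ_{n=1}^∞ b_n = ∞ and Σ_{n=1}^∞ b_n² e^{I_n} < ∞. Then the shift σ on (ℕ^ℤ, η) is conservative. -/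
open MeasureTheory ProbabilityTheory Filter

/-- The Poisson distribution on `ℕ` with parameter (rate) `a`. -/
noncomputable def pois (a : ℝ) : Measure ℕ := poissonMeasure a.toNNReal

/-- `IsProductOf η μ` says that `η` is the infinite product `⊗_{i} μ i` of the probability
measures `μ i`, i.e. `η` gives each cylinder set the corresponding product value. -/
def IsProductOf {ι : Type*} [MeasurableSpace ι] (η : Measure (ι → ℕ)) (μ : ι → Measure ℕ) : Prop :=
  ∀ (F : Finset ι) (v : ι → ℕ), η {y | ∀ i ∈ F, y i = v i} = ∏ i ∈ F, μ i {v i}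

/-- The two-sided shift `(σ y)_n = y_{n+1}` on `ℕ^ℤ`, as an invertible transformation. -/
def shift : Equiv.Perm (ℤ → ℕ) where
  toFun y n := y (n + 1)
  invFun y n := y (n - 1)
  left_inv y := funext fun n => by simp
  right_inv y := funext fun n => by simp

/-- A nonsingular transformation `S` of `(Y,ν)` is conservative if every measurable set of
positive measure returns to itself with positive measure under some positive iterate. -/
def Conservative' {Y : Type*} [MeasurableSpace Y] (S : Equiv.Perm Y)
    (ν : Measure Y) : Prop :=
  ∀ B : Set Y, MeasurableSet B → 0 < ν B →
    ∃ n : ℕ, 0 < n ∧ 0 < ν (⇑(S ^ n) ⁻¹' B ∩ B)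

open scoped ENNReal

noncomputable def dd (a c : ℝ) (j : ℕ) : ℝ≥0∞ := ENNReal.ofReal (Real.exp (a - c) * (c / a) ^ j)
noncomputable def ee (a c : ℝ) (j : ℕ) : ℝ≥0∞ :=
  ENNReal.ofReal (Real.exp (2 * (c - a)) * ((a / c) ^ 2) ^ j)

instance pois_prob (a : ℝ) : IsProbabilityMeasure (pois a) := by unfold pois; infer_instance

lemma pois_singleton {a : ℝ} (ha : 0 < a) (j : ℕ) :
    pois a {j} = ENNReal.ofReal (Real.exp (-a) * a ^ j / (j.factorial : ℝ)) := by
  rw [pois, poissonMeasure_singleton, Real.coe_toNNReal _ ha.le]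

lemma dd_mul {a c : ℝ} (ha : 0 < a) (hc : 0 < c) (j : ℕ) :
    dd a c j * pois a {j} = pois c {j} := by
  rw [pois_singleton ha, pois_singleton hc, dd, ← ENNReal.ofReal_mul (by positivity)]
  congr 1
  rw [sub_eq_add_neg, Real.exp_add, Real.exp_neg a, div_pow]
  field_simp

lemma dd_ee {a c : ℝ} (ha : 0 < a) (hc : 0 < c) (j : ℕ) :
    dd a c j ^ 2 * ee a c j = 1 := by
  rw [dd, ee, ← ENNReal.ofReal_pow (by positivity), ← ENNReal.ofReal_mul (by positivity),
    ← ENNReal.ofReal_one]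
  congr 1
  rw [mul_pow, ← Real.exp_nat_mul, div_pow, div_pow, div_pow]
  have : Real.exp (2 * (c - a)) = (Real.exp ((2:ℕ) * (a - c)))⁻¹ := by
    rw [← Real.exp_neg]; congr 1; push_cast; ring
  rw [this, div_pow, ← pow_mul, ← pow_mul, ← pow_mul, ← pow_mul, mul_comm j 2]
  field_simp

lemma lint_ee {a c : ℝ} (ha : 0 < a) (hc : 0 < c) :
    ∫⁻ j, ee a c j ∂(pois a)
      = ENNReal.ofReal (Real.exp (2 * (c - a) + ((a / c) ^ 2 - 1) * a)) := by
  rw [lintegral_countable']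
  have h := (NormedSpace.expSeries_div_hasSum_exp (𝔸 := ℝ) ((a / c) ^ 2 * a)).mul_left
    (Real.exp (2 * (c - a)) * Real.exp (-a))
  rw [← Real.exp_eq_exp_ℝ, ← Real.exp_add, ← Real.exp_add] at h
  have e1 : 2 * (c - a) + -a + (a / c) ^ 2 * a = 2 * (c - a) + ((a / c) ^ 2 - 1) * a := by ring
  rw [e1] at h
  rw [← h.tsum_eq, ENNReal.ofReal_tsum_of_nonneg (fun n => by positivity) h.summable]
  congr 1; ext j
  rw [pois_singleton ha, ee, ← ENNReal.ofReal_mul (by positivity)]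
  congr 1
  rw [mul_pow, Real.exp_add]
  ring

lemma map_restrict {η : Measure (ℤ → ℕ)} [IsProbabilityMeasure η] {a : ℤ → ℝ}
    (hη : IsProductOf η fun k => pois (a k)) (F : Finset ℤ) :
    η.map F.restrict = Measure.pi fun i : F => pois (a i) := by
  apply Measure.ext_of_singleton
  intro v
  rw [Measure.map_apply (Finset.measurable_restrict F) (measurableSet_singleton v),
    Measure.pi_singleton]
  have := hη F (fun i => if h : i ∈ F then v ⟨i, h⟩ else 0)
  rw [← Finset.prod_coe_sort] at this
  simp only [Finset.coe_mem, dite_true, Subtype.coe_eta] at this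
  rw [← this]
  congr 1
  ext y
  simp only [Set.mem_preimage, Set.mem_singleton_iff, Set.mem_ofPred_eq, funext_iff, Subtype.forall,
    Finset.restrict]
  refine forall₂_congr fun i hi => ?_
  simp [hi]

lemma pi_ineq (F : Finset ℤ) {a c : ℤ → ℝ} (ha : ∀ n, 0 < a n) (hc : ∀ n, 0 < c n)
    (S : Set (F → ℕ)) :
    (Measure.pi fun i : F => pois (a i)) S ≤
      ((Measure.pi fun i : F => pois (c i)) S) ^ (2 / 3 : ℝ) *
      (ENNReal.ofReal (Real.exp (∑ k ∈ F, (2 * (c k - a k) + ((a k / c k) ^ 2 - 1) * a k))))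
        ^ (1 / 3 : ℝ) := by
  set P := Measure.pi fun i : F => pois (a i)
  set Q := Measure.pi fun i : F => pois (c i) with hQ
  set g : (F → ℕ) → ℝ≥0∞ := fun v => ∏ i : F, dd (a i) (c i) (v i)
  set h : (F → ℕ) → ℝ≥0∞ := fun v => ∏ i : F, ee (a i) (c i) (v i)
  have hS : MeasurableSet S := S.to_countable.measurableSet
  have hQg : Q = P.withDensity g := by
    apply Measure.ext_of_singleton
    intro v
    rw [withDensity_apply _ (measurableSet_singleton v), lintegral_singleton, Measure.pi_singleton,
      Measure.pi_singleton]
    simp only [g]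
    rw [← Finset.prod_mul_distrib]
    exact Finset.prod_congr rfl fun i _ => (dd_mul (ha i) (hc i) _).symm
  have hh : ∫⁻ v, h v ∂P = ENNReal.ofReal
      (Real.exp (∑ k ∈ F, (2 * (c k - a k) + ((a k / c k) ^ 2 - 1) * a k))) := by
    have hind : iIndepFun (fun (i : F) (v : F → ℕ) => ee (a i) (c i) (v i)) P :=
      iIndepFun_pi (X := fun (i : F) => ee (a i) (c i)) (fun i => (measurable_of_countable _).aemeasurable)
    simp only [h]
    rw [lintegral_prod_eq_prod_lintegral_of_indepFun Finset.univ _ hind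
      (fun i => measurable_of_countable _), Real.exp_sum, ENNReal.ofReal_prod_of_nonneg
      (fun _ _ => by positivity), ← Finset.prod_coe_sort F]
    refine Finset.prod_congr rfl fun i _ => ?_
    rw [← lint_ee (ha i) (hc i)]
    exact (measurePreserving_eval (fun i : F => pois (a i)) i).lintegral_comp
      (measurable_of_countable _)
  have hone : ∀ v, g v ^ (2 / 3 : ℝ) * h v ^ (1 / 3 : ℝ) = 1 := by
    intro v
    have : g v ^ 2 * h v = 1 := by
      simp only [g, h]
      rw [← Finset.prod_pow, ← Finset.prod_mul_distrib]
      exact Finset.prod_eq_one fun i _ => dd_ee (ha i) (hc i) _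
    have e : g v ^ (2 / 3 : ℝ) = (g v ^ 2) ^ (1 / 3 : ℝ) := by
      rw [← ENNReal.rpow_natCast, ← ENNReal.rpow_mul]; norm_num
    rw [e, ← ENNReal.mul_rpow_of_nonneg _ _ (by norm_num), this, ENNReal.one_rpow]
  have := ENNReal.lintegral_mul_norm_pow_le (μ := P.restrict S) (f := g) (g := h)
    (measurable_of_countable _).aemeasurable (measurable_of_countable _).aemeasurable
    (p := 2 / 3) (q := 1 / 3) (by norm_num) (by norm_num) (by norm_num)
  simp only [hone, lintegral_one, Measure.restrict_apply_univ] at this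
  refine this.trans ?_
  rw [hQg, withDensity_apply _ hS, ← hh]
  gcongr
  exact Measure.restrict_le_self

lemma cyl_ineq {η ζ : Measure (ℤ → ℕ)} [IsProbabilityMeasure η] [IsProbabilityMeasure ζ]
    {a c : ℤ → ℝ} (ha : ∀ n, 0 < a n) (hc : ∀ n, 0 < c n)
    (hη : IsProductOf η fun k => pois (a k)) (hζ : IsProductOf ζ fun k => pois (c k))
    (F : Finset ℤ) (S : Set (F → ℕ)) :
    η.real (cylinder F S) ^ 3 ≤ ζ.real (cylinder F S) ^ 2 *
      Real.exp (∑ k ∈ F, (2 * (c k - a k) + ((a k / c k) ^ 2 - 1) * a k)) := by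
  have h := pi_ineq F ha hc S
  have hS : MeasurableSet S := S.to_countable.measurableSet
  rw [← map_restrict hη, ← map_restrict hζ, Measure.map_apply (Finset.measurable_restrict F) hS,
    Measure.map_apply (Finset.measurable_restrict F) hS] at h
  change η (cylinder F S) ≤ ζ (cylinder F S) ^ _ * _ at h
  have h3 := pow_le_pow_left' h 3
  rw [mul_pow, ← ENNReal.rpow_natCast, ← ENNReal.rpow_natCast, ← ENNReal.rpow_natCast,
    ← ENNReal.rpow_mul, ← ENNReal.rpow_mul] at h3
  norm_num at h3
  have h4 := ENNReal.toReal_mono (by finiteness) h3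
  simpa [ENNReal.toReal_ofReal (Real.exp_pos _).le, Measure.real] using h4

lemma cyl_mono (F G : Finset ℤ) (h : F ⊆ G) (S : Set (F → ℕ)) :
    cylinder (α := fun _ : ℤ => ℕ) F S = cylinder G (Finset.restrict₂ h ⁻¹' S) := by
  ext y; simp [cylinder]; rfl

lemma cyl_ineq' {η ζ : Measure (ℤ → ℕ)} [IsProbabilityMeasure η] [IsProbabilityMeasure ζ]
    {a c : ℤ → ℝ} (ha : ∀ n, 0 < a n) (hc : ∀ n, 0 < c n)
    (hη : IsProductOf η fun k => pois (a k)) (hζ : IsProductOf ζ fun k => pois (c k))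
    {I : ℝ} (hI : HasSum (fun k => 2 * (c k - a k) + ((a k / c k) ^ 2 - 1) * a k) I)
    (F : Finset ℤ) (S : Set (F → ℕ)) :
    η.real (cylinder F S) ^ 3 ≤ ζ.real (cylinder F S) ^ 2 * Real.exp I := by
  have h1 := ((Real.continuous_exp.tendsto I).comp hI).const_mul (ζ.real (cylinder F S) ^ 2)
  refine ge_of_tendsto h1 ?_
  filter_upwards [eventually_ge_atTop F] with G hG
  rw [cyl_mono F G hG S]
  exact cyl_ineq ha hc hη hζ G _

lemma gen_ineq {η ζ : Measure (ℤ → ℕ)} [IsProbabilityMeasure η] [IsProbabilityMeasure ζ]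
    {a c : ℤ → ℝ} (ha : ∀ n, 0 < a n) (hc : ∀ n, 0 < c n)
    (hη : IsProductOf η fun k => pois (a k)) (hζ : IsProductOf ζ fun k => pois (c k))
    {I : ℝ} (hI : HasSum (fun k => 2 * (c k - a k) + ((a k / c k) ^ 2 - 1) * a k) I)
    {B : Set (ℤ → ℕ)} (hB : MeasurableSet B) :
    η.real B ^ 3 ≤ ζ.real B ^ 2 * Real.exp I := by
  have key : ∀ m : ℕ, ∃ t ∈ measurableCylinders (fun _ : ℤ => ℕ),
      (η + ζ) (symmDiff t B) < ENNReal.ofReal (1 / ((m : ℝ) + 1)) := fun m =>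
    exists_measure_symmDiff_lt_of_generateFrom_isSetRing isSetRing_measurableCylinders
      ⟨{Set.univ}, Set.countable_singleton _, by
        rw [Set.singleton_subset_iff]
        exact (mem_measurableCylinders Set.univ).2 ⟨∅, Set.univ, MeasurableSet.univ, by simp⟩, by simp⟩
      generateFrom_measurableCylinders.symm hB (by simp; positivity)
  choose t ht htm using key
  have hlim : ∀ ν : Measure (ℤ → ℕ), IsProbabilityMeasure ν → ν ≤ η + ζ →
      Tendsto (fun m => ν.real (t m)) atTop (nhds (ν.real B)) := by
    intro ν _ hν
    rw [tendsto_iff_dist_tendsto_zero]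
    refine squeeze_zero (fun _ => dist_nonneg) (fun m => ?_)
      tendsto_one_div_add_atTop_nhds_zero_nat
    rw [Real.dist_eq]
    have h1 : ν (symmDiff (t m) B) ≤ ENNReal.ofReal (1 / ((m : ℝ) + 1)) :=
      (hν _).trans (htm m).le
    have h2 : ν.real (symmDiff (t m) B) ≤ 1 / ((m : ℝ) + 1) :=
      ENNReal.toReal_le_of_le_ofReal (by positivity) h1
    refine le_trans ?_ h2
    exact abs_measureReal_sub_le_measureReal_symmDiff
      (MeasurableSet.of_mem_measurableCylinders (ht m)).nullMeasurableSet hB.nullMeasurableSet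
  have l1 := (hlim η inferInstance (Measure.le_add_right le_rfl)).pow 3
  have l2 := ((hlim ζ inferInstance (Measure.le_add_left le_rfl)).pow 2).mul_const (Real.exp I)
  refine le_of_tendsto_of_tendsto' l1 l2 fun m => ?_
  obtain ⟨F, S, -, h⟩ := (mem_measurableCylinders _).1 (ht m)
  rw [h]
  exact cyl_ineq' ha hc hη hζ hI F S

def gsh (n : ℤ) (y : ℤ → ℕ) : ℤ → ℕ := fun k => y (k - n)

lemma gsh_meas (n : ℤ) : Measurable (gsh n) := by unfold gsh; fun_prop

lemma prod_shift {η : Measure (ℤ → ℕ)} [IsProbabilityMeasure η] {a : ℤ → ℝ}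
    (hη : IsProductOf η fun k => pois (a k)) (n : ℤ) :
    IsProductOf (η.map (gsh n)) fun k => pois (a (k - n)) := by
  intro F v
  have hm : MeasurableSet {y : ℤ → ℕ | ∀ i ∈ F, y i = v i} := by
    have : {y : ℤ → ℕ | ∀ i ∈ F, y i = v i} = ⋂ i ∈ F, (fun y => y i) ⁻¹' {v i} := by
      ext; simp
    rw [this]
    exact Finset.measurableSet_biInter _ fun i _ => measurable_pi_apply i (measurableSet_singleton _)
  rw [Measure.map_apply (gsh_meas n) hm]
  have := hη (F.image (· - n)) (fun k => v (k + n))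
  rw [Finset.prod_image (by intro x _ y _ h; simpa using h)] at this
  simp only [sub_add_cancel] at this
  rw [← this]
  congr 1
  ext y; simp [gsh]

lemma hasSum_tel (a : ℤ → ℝ) (hsum : Summable fun k : ℤ => |a (k - 1) - a k|)
    (hlim : ∃ c : ℝ, Tendsto a atTop (nhds c) ∧ Tendsto a atBot (nhds c)) (n : ℕ) :
    HasSum (fun k : ℤ => a (k - n) - a k) 0 := by
  obtain ⟨c, hc1, hc2⟩ := hlim
  have h1 : HasSum (fun k : ℤ => a (k - 1) - a k) 0 := by
    have hs : Summable (fun k : ℤ => a (k - 1) - a k) := hsum.of_abs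
    have hf : Tendsto (fun N : ℕ => Finset.Ico (-(N:ℤ)) N) atTop atTop :=
      Finset.tendsto_Ico_neg
    have ht := hs.hasSum.comp hf
    have e : ∀ N : ℕ, ∑ k ∈ Finset.Ico (-(N:ℤ)) N, (a (k - 1) - a k)
        = a (-(N:ℤ) - 1) - a ((N:ℤ) - 1) := by
      intro N
      induction N with
      | zero => simp
      | succ N ih =>
        have : Finset.Ico (-((N+1:ℕ):ℤ)) ((N+1:ℕ):ℤ)
            = insert (-(N:ℤ)-1) (insert (N:ℤ) (Finset.Ico (-(N:ℤ)) N)) := by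
          ext x; simp; omega
        rw [this, Finset.sum_insert (by simp), Finset.sum_insert (by simp), ih]
        push_cast
        have e1 : -((N:ℤ)+1) - 1 = -(N:ℤ) - 1 - 1 := by ring
        rw [e1, add_sub_cancel_right]; ring
    have ht2 : Tendsto (fun N : ℕ => a (-(N:ℤ) - 1) - a ((N:ℤ) - 1)) atTop (nhds (c - c)) := by
      refine (hc2.comp ?_).sub (hc1.comp ?_)
      · exact tendsto_atBot_add_const_right _ (-1)
          (tendsto_neg_atTop_atBot.comp tendsto_natCast_atTop_atTop)
      · exact tendsto_atTop_add_const_right _ (-1) tendsto_natCast_atTop_atTop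
    have : (∑' k : ℤ, (a (k - 1) - a k)) = 0 := by
      rw [← sub_self c]
      refine tendsto_nhds_unique ht (ht2.congr fun N => ?_)
      rw [← e N]; rfl
    rw [← this]; exact hs.hasSum
  induction n with
  | zero => simp
  | succ n ih =>
    have h2 := (Equiv.subRight (n:ℤ)).hasSum_iff.2 h1
    have h3 := h2.add ih
    rw [add_zero] at h3
    convert h3 using 1
    ext k
    simp only [Function.comp, Equiv.subRight_apply]
    have e1 : k - ((n + 1 : ℕ) : ℤ) = k - n - 1 := by push_cast; ring
    rw [e1]; ring

lemma shift_pow (n : ℕ) (y : ℤ → ℕ) (k : ℤ) : (shift ^ n) y k = y (k + n) := by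
  induction n generalizing k with
  | zero => simp
  | succ n ih =>
    rw [pow_succ', Equiv.Perm.mul_apply]
    change (shift ^ n) y (k + 1) = _
    rw [ih]; congr 1; push_cast; ring

/-- Let `(a_k)_{k∈ℤ}` be positive reals with `Σ_k |a_{k-1} - a_k| < ∞` and
`lim_{k→+∞} a_k = lim_{k→-∞} a_k`.  Suppose that for every `n ≥ 1` the series
`I_n := Σ_{k∈ℤ} ((a_k/a_{k-n})² - 1) a_k` converges absolutely and that there is a sequence
`(b_n)_{n≥1}` of positive reals with `Σ b_n = ∞` and `Σ b_n² e^{I_n} < ∞`.  Then the shift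
on `(ℕ^ℤ, η)`, `η = ⊗_{k∈ℤ} Pois(a_k)`, is conservative. -/
theorem stmt8 (a : ℤ → ℝ) (ha : ∀ n, 0 < a n)
    (hsum : Summable fun k : ℤ => |a (k - 1) - a k|)
    (hlim : ∃ c : ℝ, Tendsto a atTop (nhds c) ∧ Tendsto a atBot (nhds c))
    (hI : ∀ n : ℕ, 0 < n →
      Summable fun k : ℤ => |((a k / a (k - (n : ℤ))) ^ 2 - 1) * a k|)
    (b : ℕ → ℝ) (hb : ∀ n, 0 < b n) (hbdiv : ¬ Summable b)
    (hbconv : Summable fun n : ℕ => b n ^ 2 *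
      Real.exp (∑' k : ℤ, ((a k / a (k - ((n : ℤ) + 1))) ^ 2 - 1) * a k))
    (η : Measure (ℤ → ℕ)) [IsProbabilityMeasure η]
    (hη : IsProductOf η fun k => pois (a k)) :
    Conservative' shift η := by
  intro B hB hBpos
  by_contra! hcon
  have hmeas : ∀ n : ℕ, Measurable (⇑(shift ^ n)) := fun n =>
    measurable_pi_lambda _ fun k => by
      simp only [shift_pow]; exact measurable_pi_apply _
  set W : Set (ℤ → ℕ) := B \ ⋃ n : ℕ, (⇑(shift ^ (n + 1)) ⁻¹' B) with hW
  have hWm : MeasurableSet W := hB.diff (MeasurableSet.iUnion fun n => hmeas _ hB)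
  have hWB : η W = η B := by
    rw [hW, ← Set.sdiff_inter_self_eq_sdiff]
    refine measure_sdiff_null ?_
    rw [Set.iUnion_inter]
    exact measure_iUnion_null fun n => le_antisymm (hcon (n + 1) n.succ_pos) zero_le
  have hWpos : 0 < η.real W := by
    rw [Measure.real, hWB]; exact ENNReal.toReal_pos hBpos.ne' (measure_ne_top _ _)
  set J : ℕ → ℝ := fun n => ∑' k : ℤ, ((a k / a (k - ((n : ℤ) + 1))) ^ 2 - 1) * a k with hJ
  have hineq : ∀ n : ℕ, η.real W ^ 3 ≤ (η.real (gsh (n + 1) ⁻¹' W)) ^ 2 * Real.exp (J n) := by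
    intro n
    have : IsProbabilityMeasure (η.map (gsh (n + 1))) :=
      Measure.isProbabilityMeasure_map (gsh_meas _).aemeasurable
    have hs : HasSum (fun k : ℤ => ((a k / a (k - ((n : ℤ) + 1))) ^ 2 - 1) * a k) (J n) := by
      have := (hI (n + 1) n.succ_pos).of_abs.hasSum
      push_cast at this
      exact this
    have ht := (hasSum_tel a hsum hlim (n + 1)).mul_left 2
    have h := ht.add hs
    rw [mul_zero, zero_add] at h
    push_cast at h
    have := gen_ineq ha (fun k => ha (k - (n + 1))) hη (prod_shift hη (n + 1)) h hWm
    rwa [map_measureReal_apply (gsh_meas _) hWm] at this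
  have hdisj : Pairwise (Function.onFun Disjoint fun n : ℕ => gsh ((n : ℤ) + 1) ⁻¹' W) := by
    refine (pairwise_disjoint_on _).2 fun m n hmn => ?_
    rw [Set.disjoint_left]
    intro y hy1 hy2
    refine hy2.2 (Set.mem_iUnion.2 ⟨n - m - 1, ?_⟩)
    have : (shift ^ (n - m - 1 + 1)) (gsh ((n : ℤ) + 1) y) = gsh ((m : ℤ) + 1) y := by
      ext k
      rw [shift_pow]; simp only [gsh]; congr 1; push_cast; omega
    rw [Set.mem_preimage, this]
    exact hy1.1
  have hsumm : Summable fun n : ℕ => η.real (gsh ((n : ℤ) + 1) ⁻¹' W) := by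
    refine ENNReal.summable_toReal ?_
    rw [← measure_iUnion hdisj fun n => gsh_meas _ hWm]
    exact measure_ne_top _ _
  apply hbdiv
  obtain ⟨M, hM⟩ := hbconv.tendsto_atTop_zero.bddAbove_range
  have hM' : ∀ n, b n ^ 2 * Real.exp (J n) ≤ M := fun n => hM ⟨n, rfl⟩
  have hM0 : 0 < M := lt_of_lt_of_le (by have := hb 0; positivity) (hM' 0)
  refine Summable.of_nonneg_of_le (fun n => (hb n).le) (fun n => ?_)
    (hsumm.mul_left (√(M / η.real W ^ 3)))
  set w := η.real W
  set q := η.real (gsh ((n : ℤ) + 1) ⁻¹' W)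
  have hq : 0 ≤ q := measureReal_nonneg
  have h1 := hineq n
  have h2 := hM' n
  refine le_of_sq_le_sq ?_ (by positivity)
  rw [mul_pow, Real.sq_sqrt (by positivity), div_mul_eq_mul_div, le_div_iff₀ (by positivity)]
  calc b n ^ 2 * w ^ 3 ≤ b n ^ 2 * (q ^ 2 * Real.exp (J n)) := by gcongr
    _ = (b n ^ 2 * Real.exp (J n)) * q ^ 2 := by ring
    _ ≤ M * q ^ 2 := by gcongr
end

section
/- Define ε : ℤ → ℝ by ε_k = −k^{-1/2} for integers k ≥ 2 and ε_k = 0 for k ≤ 1. Then for every n ≥ 1 the series Σ_{k∈ℤ} ( e^{(ε_{k+n} − ε_k)/2} − 1 )² e^{ε_k} converges, and there is a constant C > 0 such that for all integers n ≥ 2, | Σ_{k∈ℤ} ( e^{(ε_{k+n} − ε_k)/2} − 1 )² e^{ε_k} − (1/2) log n | ≤ C. -/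
/-- `eps k = -k^{-1/2}` for integers `k ≥ 2` and `eps k = 0` for `k ≤ 1`. -/
noncomputable def eps (k : ℤ) : ℝ := if 2 ≤ k then -(Real.sqrt k)⁻¹ else 0

noncomputable def hh (k : ℕ) : ℝ := 1 - Real.exp (eps (k : ℤ) / 2)

lemma hh_zero : hh 0 = 0 := by simp [hh, eps]

lemma hh_one : hh 1 = 0 := by simp [hh, eps]

lemma hh_eq (k : ℕ) (hk : 2 ≤ k) : hh k = 1 - Real.exp (-(Real.sqrt k)⁻¹ / 2) := by
  have : (2 : ℤ) ≤ (k : ℤ) := by exact_mod_cast hk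
  simp [hh, eps, this]

lemma hh_nonneg (k : ℕ) : 0 ≤ hh k := by
  rcases Nat.lt_or_ge k 2 with h | h
  · interval_cases k
    · rw [hh_zero]
    · rw [hh_one]
  · rw [hh_eq k h]
    have : Real.exp (-(Real.sqrt k)⁻¹ / 2) ≤ 1 := by
      apply Real.exp_le_one_iff.2
      have : 0 ≤ (Real.sqrt k)⁻¹ := by positivity
      linarith
    linarith

lemma hh_le (k : ℕ) : hh k ≤ (Real.sqrt k)⁻¹ / 2 := by
  rcases Nat.lt_or_ge k 2 with h | h
  · interval_cases k
    · rw [hh_zero]; positivity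
    · rw [hh_one]; positivity
  · rw [hh_eq k h]
    have := Real.add_one_le_exp (-(Real.sqrt k)⁻¹ / 2)
    linarith

lemma exp_neg_le (x : ℝ) (hx : 0 ≤ x) : Real.exp (-x) ≤ 1 - x + x ^ 2 := by
  have h1 : 1 + x ≤ Real.exp x := by linarith [Real.add_one_le_exp x]
  rw [Real.exp_neg]
  rw [inv_le_comm₀ (Real.exp_pos x) (by nlinarith [sq_nonneg (x - 1)])]
  refine le_trans ?_ h1
  rw [inv_le_iff_one_le_mul₀ (by nlinarith [sq_nonneg (x - 1)])]
  nlinarith [pow_nonneg hx 3]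

lemma hh_sq (k : ℕ) : |hh k ^ 2 - 1 / 4 * (k : ℝ)⁻¹| ≤ 1 / 4 * ((k : ℝ)⁻¹ * (Real.sqrt k)⁻¹) := by
  rcases Nat.lt_or_ge k 2 with h | h
  · interval_cases k
    · rw [hh_zero]; simp
    · rw [hh_one]; norm_num [abs_of_nonneg]
  · have hu := hh_le k
    have h0 := hh_nonneg k
    have hs : 0 ≤ (Real.sqrt k)⁻¹ := by positivity
    have hsq : (k : ℝ)⁻¹ = ((Real.sqrt k)⁻¹) ^ 2 := by
      rw [inv_pow, Real.sq_sqrt (by positivity)]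
    have hl := exp_neg_le ((Real.sqrt k)⁻¹ / 2) (by positivity)
    have he := hh_eq k h
    rw [neg_div] at he
    rw [hsq]
    set s := (Real.sqrt k)⁻¹
    have hl' : s / 2 - s ^ 2 / 4 ≤ hh k := by rw [he]; linarith
    generalize hh k = H at *
    rw [abs_le]
    constructor
    · nlinarith [mul_nonneg (sub_nonneg.2 hu) (sub_nonneg.2 hu), mul_nonneg hs (sub_nonneg.2 hl'), mul_nonneg h0 (sub_nonneg.2 hl')]
    · nlinarith [pow_nonneg hs 3]

lemma sum_sqrt' (n : ℕ) :
    ∑ k ∈ Finset.range (n + 1), (Real.sqrt k)⁻¹ ≤ 2 * Real.sqrt n := by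
  induction n with
  | zero => simp
  | succ n ih =>
    rw [Finset.sum_range_succ]
    have hb : 0 < Real.sqrt ((n + 1 : ℕ) : ℝ) := Real.sqrt_pos.2 (by positivity)
    have hb2 : Real.sqrt ((n + 1 : ℕ) : ℝ) ^ 2 = n + 1 := by
      rw [Real.sq_sqrt (by positivity)]; push_cast; rfl
    have ha2 : Real.sqrt (n : ℝ) ^ 2 = n := Real.sq_sqrt (by positivity)
    have h1 : (Real.sqrt ((n + 1 : ℕ) : ℝ))⁻¹
        ≤ 2 * (Real.sqrt ((n + 1 : ℕ) : ℝ) - Real.sqrt n) := by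
      rw [inv_le_iff_one_le_mul₀ hb]
      nlinarith [sq_nonneg (Real.sqrt ((n + 1 : ℕ) : ℝ) - Real.sqrt n)]
    linarith

lemma sum_sqrt (n : ℕ) : ∑ k ∈ Finset.range n, (Real.sqrt k)⁻¹ ≤ 2 * Real.sqrt n := by
  refine le_trans ?_ (sum_sqrt' n)
  rw [Finset.sum_range_succ]
  have : 0 ≤ (Real.sqrt n)⁻¹ := by positivity
  linarith

lemma diff_bound (n k : ℕ) (hk : 2 ≤ k) :
    (hh (k + n) - hh k) ^ 2 ≤ n * ((k : ℝ) - 1)⁻¹ - n * (k : ℝ)⁻¹ := by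
  have hk' : (2 : ℝ) ≤ k := by exact_mod_cast hk
  have hk0 : (0 : ℝ) < k := by linarith
  have hsq : (k : ℝ)⁻¹ = ((Real.sqrt k)⁻¹) ^ 2 := by
    rw [inv_pow, Real.sq_sqrt (by positivity)]
  have htq : ((k + n : ℕ) : ℝ)⁻¹ = ((Real.sqrt ((k + n : ℕ) : ℝ))⁻¹) ^ 2 := by
    rw [inv_pow, Real.sq_sqrt (by positivity)]
  have hts : (Real.sqrt ((k + n : ℕ) : ℝ))⁻¹ ≤ (Real.sqrt k)⁻¹ := by
    apply inv_anti₀ (Real.sqrt_pos.2 hk0)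
    apply Real.sqrt_le_sqrt
    push_cast; linarith [Nat.cast_nonneg (α := ℝ) n]
  have ht0 : 0 ≤ (Real.sqrt ((k + n : ℕ) : ℝ))⁻¹ := by positivity
  have e1 := hh_eq k hk
  have e2 := hh_eq (k + n) (by omega)
  have hfin : (k : ℝ)⁻¹ - ((k + n : ℕ) : ℝ)⁻¹ ≤ n * ((k : ℝ) - 1)⁻¹ - n * (k : ℝ)⁻¹ := by
    have hk1 : (0 : ℝ) < k - 1 := by linarith
    have hn : (0 : ℝ) ≤ n := Nat.cast_nonneg n
    have l : (k : ℝ)⁻¹ - ((k + n : ℕ) : ℝ)⁻¹ = n / (k * (k + n)) := by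
      push_cast; field_simp; ring
    have r : n * ((k : ℝ) - 1)⁻¹ - n * (k : ℝ)⁻¹ = n / (k * (k - 1)) := by
      field_simp; ring
    rw [l, r]
    apply div_le_div_of_nonneg_left hn (by positivity)
    apply mul_le_mul_of_nonneg_left _ hk0.le
    linarith
  refine le_trans ?_ hfin
  rw [hsq, htq, e1, e2]
  generalize (Real.sqrt ((k + n : ℕ) : ℝ))⁻¹ = t at *
  generalize (Real.sqrt (k : ℝ))⁻¹ = s at *
  have h1 : Real.exp (-s / 2) ≤ Real.exp (-t / 2) := Real.exp_le_exp.2 (by linarith)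
  have h2 : Real.exp (-t / 2) - Real.exp (-s / 2) ≤ (s - t) / 2 := by
    have e : Real.exp (-s / 2) = Real.exp (-t / 2) * Real.exp (-(s - t) / 2) := by
      rw [← Real.exp_add]; congr 1; ring
    have h3 := Real.add_one_le_exp (-(s - t) / 2)
    have h4 : Real.exp (-t / 2) ≤ 1 := Real.exp_le_one_iff.2 (by linarith)
    have h5 := Real.exp_pos (-t / 2)
    rw [e]
    nlinarith
  generalize Real.exp (-t / 2) = x at *
  generalize Real.exp (-s / 2) = y at *
  nlinarith [mul_nonneg ht0 (sub_nonneg.2 hts)]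

lemma tail_partial (n : ℕ) (hn : 2 ≤ n) (N : ℕ) :
    ∑ j ∈ Finset.range N, (hh (j + n + n) - hh (j + n)) ^ 2
      ≤ n * ((n : ℝ) - 1)⁻¹ - n * ((N : ℝ) + n - 1)⁻¹ := by
  induction N with
  | zero => simp
  | succ N ih =>
    rw [Finset.sum_range_succ]
    have := diff_bound n (N + n) (by omega)
    push_cast at this ⊢
    have e : (N : ℝ) + 1 + n - 1 = N + n := by ring
    rw [e]
    linarith

lemma tail_partial' (n : ℕ) (hn : 2 ≤ n) (N : ℕ) :
    ∑ j ∈ Finset.range N, (hh (j + n + n) - hh (j + n)) ^ 2 ≤ 2 := by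
  refine (tail_partial n hn N).trans ?_
  have hn' : (2 : ℝ) ≤ n := by exact_mod_cast hn
  have h1 : (0 : ℝ) ≤ n * ((N : ℝ) + n - 1)⁻¹ := by
    apply mul_nonneg (by positivity)
    apply inv_nonneg.2
    linarith [Nat.cast_nonneg (α := ℝ) N]
  have h2 : n * ((n : ℝ) - 1)⁻¹ ≤ 2 := by
    rw [← div_eq_mul_inv, div_le_iff₀ (by linarith)]; linarith
  linarith

lemma nat_summable (n : ℕ) : Summable fun k : ℕ => (hh (k + n) - hh k) ^ 2 := by
  rw [← summable_nat_add_iff 2]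
  apply summable_of_sum_range_le (c := n) (fun _ => sq_nonneg _)
  intro N
  have : ∑ j ∈ Finset.range N, (hh (j + 2 + n) - hh (j + 2)) ^ 2
      ≤ n - n * ((N : ℝ) + 1)⁻¹ := by
    induction N with
    | zero => simp
    | succ N ih =>
      rw [Finset.sum_range_succ]
      have := diff_bound n (N + 2) (by omega)
      push_cast at this ⊢
      have e : (N : ℝ) + 2 - 1 = N + 1 := by ring
      have e' : (N : ℝ) + 1 + 1 = N + 2 := by ring
      rw [e] at this
      rw [e']
      linarith
  have h : (0 : ℝ) ≤ n * ((N : ℝ) + 1)⁻¹ := by positivity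
  linarith

noncomputable def TT (n : ℕ) (k : ℤ) : ℝ :=
  (Real.exp ((eps (k + (n : ℤ)) - eps k) / 2) - 1) ^ 2 * Real.exp (eps k)

lemma TT_eq (n : ℕ) (k : ℤ) :
    TT n k = (Real.exp (eps (k + n) / 2) - Real.exp (eps k / 2)) ^ 2 := by
  unfold TT
  have e : Real.exp (eps k) = Real.exp (eps k / 2) ^ 2 := by
    rw [sq, ← Real.exp_add]; congr 1; ring
  rw [e, ← mul_pow, sub_mul, ← Real.exp_add]
  congr 3
  · congr 1; ring
  · ring

lemma TT_nat (n k : ℕ) : TT n (k : ℤ) = (hh (k + n) - hh k) ^ 2 := by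
  rw [TT_eq, hh, hh]; push_cast; ring

lemma eps_neg (k : ℤ) (hk : k ≤ 1) : eps k = 0 := by
  unfold eps; rw [if_neg (by omega)]

lemma TT_neg_small (n j : ℕ) (h : j < n) : TT n (-((j : ℤ) + 1)) = hh (n - 1 - j) ^ 2 := by
  rw [TT_eq, hh, eps_neg (-((j : ℤ) + 1)) (by omega)]
  have : -((j : ℤ) + 1) + n = ((n - 1 - j : ℕ) : ℤ) := by omega
  rw [this]; simp; ring

lemma TT_neg_big (n j : ℕ) (h : n ≤ j) : TT n (-((j : ℤ) + 1)) = 0 := by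
  rw [TT_eq, eps_neg (-((j : ℤ) + 1)) (by omega), eps_neg _ (by omega)]
  simp

lemma TT_hasSum (n : ℕ) : HasSum (TT n)
    ((∑' k : ℕ, (hh (k + n) - hh k) ^ 2) + ∑ m ∈ Finset.range n, hh m ^ 2) := by
  apply HasSum.of_nat_of_neg_add_one
  · simp_rw [TT_nat]
    exact (nat_summable n).hasSum
  · rw [← Finset.sum_range_reflect]
    have : ∑ j ∈ Finset.range n, hh (n - 1 - j) ^ 2
        = ∑ j ∈ Finset.range n, TT n (-((j : ℤ) + 1)) :=
      Finset.sum_congr rfl fun j hj => (TT_neg_small n j (Finset.mem_range.1 hj)).symm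
    rw [this]
    apply hasSum_sum_of_ne_finset_zero
    intro j hj
    exact TT_neg_big n j (by simpa using hj)

lemma harm (n : ℕ) (hn : 2 ≤ n) :
    |∑ k ∈ Finset.range n, (k : ℝ)⁻¹ - Real.log n| ≤ 1 := by
  obtain ⟨p, rfl⟩ : ∃ p, n = p + 1 := ⟨n - 1, by omega⟩
  have hp : (1 : ℝ) ≤ p := by exact_mod_cast (by omega : 1 ≤ p)
  have e : ∑ k ∈ Finset.range (p + 1), (k : ℝ)⁻¹ = ((harmonic p : ℚ) : ℝ) := by
    rw [Finset.sum_range_succ']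
    simp [harmonic]
  have h1 := log_add_one_le_harmonic p
  have h2 := harmonic_le_one_add_log p
  have h3 : Real.log p ≤ Real.log ((p + 1 : ℕ) : ℝ) :=
    Real.log_le_log (by linarith) (by push_cast; linarith)
  rw [e, abs_le]
  push_cast at *
  constructor <;> linarith

lemma summ32 : Summable fun k : ℕ => (k : ℝ)⁻¹ * (Real.sqrt k)⁻¹ := by
  have h := Real.summable_nat_rpow_inv.2 (show (1 : ℝ) < 3 / 2 by norm_num)
  refine h.congr fun k => ?_
  rw [← mul_inv]
  congr 1
  rcases Nat.eq_zero_or_pos k with rfl | hk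
  · norm_num
  · have : (0 : ℝ) < k := by exact_mod_cast hk
    rw [Real.sqrt_eq_rpow, show (3 / 2 : ℝ) = 1 + 1 / 2 by norm_num, Real.rpow_add this,
      Real.rpow_one]

lemma Q_bound : ∃ K : ℝ, 0 ≤ K ∧ ∀ n : ℕ, 2 ≤ n →
    |∑ m ∈ Finset.range n, hh m ^ 2 - 1 / 4 * Real.log n| ≤ K := by
  refine ⟨1 / 4 * (∑' k : ℕ, (k : ℝ)⁻¹ * (Real.sqrt k)⁻¹) + 1 / 4, ?_, ?_⟩
  · have : 0 ≤ ∑' k : ℕ, (k : ℝ)⁻¹ * (Real.sqrt k)⁻¹ := tsum_nonneg fun k => by positivity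
    linarith
  · intro n hn
    have h1 : |∑ m ∈ Finset.range n, (hh m ^ 2 - 1 / 4 * (m : ℝ)⁻¹)|
        ≤ 1 / 4 * (∑' k : ℕ, (k : ℝ)⁻¹ * (Real.sqrt k)⁻¹) := by
      refine (Finset.abs_sum_le_sum_abs _ _).trans ?_
      refine (Finset.sum_le_sum fun m _ => hh_sq m).trans ?_
      rw [← Finset.mul_sum]
      apply mul_le_mul_of_nonneg_left _ (by norm_num)
      exact summ32.sum_le_tsum _ fun k _ => by positivity
    rw [Finset.sum_sub_distrib, ← Finset.mul_sum] at h1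
    have h2 := harm n hn
    rw [abs_le] at *
    constructor <;> linarith [h1.1, h1.2, h2.1, h2.2]

lemma head_bound (n : ℕ) (hn : 2 ≤ n) :
    |∑ k ∈ Finset.range n, (hh (k + n) - hh k) ^ 2 - ∑ k ∈ Finset.range n, hh k ^ 2| ≤ 2 := by
  have hn' : (2 : ℝ) ≤ n := by exact_mod_cast hn
  have hsn : 0 < Real.sqrt n := Real.sqrt_pos.2 (by linarith)
  have hss : Real.sqrt n ^ 2 = n := Real.sq_sqrt (by linarith)
  rw [← Finset.sum_sub_distrib]
  refine (Finset.abs_sum_le_sum_abs _ _).trans ?_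
  have key : ∀ k ∈ Finset.range n, |(hh (k + n) - hh k) ^ 2 - hh k ^ 2|
      ≤ 1 / 2 * (Real.sqrt n)⁻¹ * (Real.sqrt k)⁻¹ + 1 / 4 * (n : ℝ)⁻¹ := by
    intro k _
    have a0 := hh_nonneg k
    have a1 := hh_le k
    have b0 := hh_nonneg (k + n)
    have b1 : hh (k + n) ≤ (Real.sqrt n)⁻¹ / 2 := by
      refine (hh_le (k + n)).trans ?_
      apply div_le_div_of_nonneg_right _ (by norm_num)
      apply inv_anti₀ hsn
      apply Real.sqrt_le_sqrt
      push_cast; linarith [Nat.cast_nonneg (α := ℝ) k]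
    have hq : (n : ℝ)⁻¹ = (Real.sqrt n)⁻¹ ^ 2 := by rw [inv_pow, hss]
    rw [hq]
    generalize (Real.sqrt (n : ℝ))⁻¹ = t at *
    generalize (Real.sqrt (k : ℝ))⁻¹ = s at *
    generalize hh (k + n) = b at *
    generalize hh k = a at *
    have h1 : a * b ≤ (s / 2) * (t / 2) := mul_le_mul a1 b1 b0 (by linarith)
    have h2 : b * b ≤ (t / 2) * (t / 2) := mul_le_mul b1 b1 b0 (by linarith)
    have h3 := mul_nonneg a0 b0
    have h4 := mul_nonneg b0 b0
    rw [abs_le]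
    constructor <;> nlinarith
  refine (Finset.sum_le_sum key).trans ?_
  rw [Finset.sum_add_distrib, ← Finset.mul_sum, Finset.sum_const, Finset.card_range, nsmul_eq_mul]
  have h1 : 1 / 2 * (Real.sqrt n)⁻¹ * ∑ k ∈ Finset.range n, (Real.sqrt k)⁻¹
      ≤ 1 / 2 * (Real.sqrt n)⁻¹ * (2 * Real.sqrt n) :=
    mul_le_mul_of_nonneg_left (sum_sqrt n) (by positivity)
  have h2 : 1 / 2 * (Real.sqrt n)⁻¹ * (2 * Real.sqrt n) = 1 := by field_simp
  have h3 : (n : ℝ) * (1 / 4 * (n : ℝ)⁻¹) = 1 / 4 := by field_simp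
  linarith

/-- For every `n ≥ 1` the series `Σ_{k∈ℤ} (e^{(ε_{k+n} - ε_k)/2} - 1)² e^{ε_k}` converges,
and there is `C > 0` such that for all `n ≥ 2`,
`|Σ_{k∈ℤ} (e^{(ε_{k+n} - ε_k)/2} - 1)² e^{ε_k} - (1/2) log n| ≤ C`. -/
theorem stmt15 :
    (∀ n : ℕ, 1 ≤ n → Summable fun k : ℤ =>
      (Real.exp ((eps (k + (n : ℤ)) - eps k) / 2) - 1) ^ 2 * Real.exp (eps k)) ∧
    ∃ C : ℝ, 0 < C ∧ ∀ n : ℕ, 2 ≤ n →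
      |(∑' k : ℤ, (Real.exp ((eps (k + (n : ℤ)) - eps k) / 2) - 1) ^ 2 * Real.exp (eps k))
        - 1 / 2 * Real.log n| ≤ C := by
  refine ⟨fun n _ => (TT_hasSum n).summable, ?_⟩
  obtain ⟨K, hK, hQ⟩ := Q_bound
  refine ⟨2 * K + 4, by linarith, fun n hn => ?_⟩
  have h := (TT_hasSum n).tsum_eq
  unfold TT at h
  rw [h, ← (nat_summable n).sum_add_tsum_nat_add n]
  have h1 := hQ n hn
  have h2 := head_bound n hn
  have h3 : ∑' j : ℕ, (hh (j + n + n) - hh (j + n)) ^ 2 ≤ 2 :=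
    Real.tsum_le_of_sum_range_le (fun _ => sq_nonneg _) (tail_partial' n hn)
  have h4 : 0 ≤ ∑' j : ℕ, (hh (j + n + n) - hh (j + n)) ^ 2 := tsum_nonneg fun _ => sq_nonneg _
  rw [abs_le] at *
  constructor <;> linarith [h1.1, h1.2, h2.1, h2.2]
end
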